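/- There exists a constant C > 0 such that for every s ∈ ℕ⁺ there exist M = M(s) > 0 and signs σ_1,…,σ_s ∈ {−1,+1} with the following property: whenever d^1,…,d^s ∈ ℤ^d \ {0} satisfy |d^{k+1}| > M |d^k| for k = 1,…,s−1, then ∫_{[0,1]^d} | ∑_{j=1}^s σ_j cos(2π⟨d^j,ξ⟩) ∏_{1≤k<j} (1 + cos(2π⟨d^k,ξ⟩)) | dξ ≥ C s. -/

import Mathlib

open MeasureTheory Filter Real Topology

/-- Euclidean norm of an integer vector in `ℤ^d`. -/
noncomputable def intNorm {d : ℕ} (n : Fin d → ℤ) : ℝ :=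
  Real.sqrt (∑ i, ((n i : ℝ)) ^ 2)

/-- Lebesgue measure on the unit interval. -/
noncomputable abbrev unitMeasure : Measure ℝ := volume.restrict (Set.Icc 0 1)

instance : IsProbabilityMeasure unitMeasure := ⟨by simp [unitMeasure]⟩

theorem restrict_unitCube {n : ℕ} :
    (volume : Measure (Fin n → ℝ)).restrict (Set.Icc 0 1) =
      Measure.pi fun _ => unitMeasure := by
  rw [unitMeasure, ← Measure.restrict_pi_pi, Set.pi_univ_Icc]
  rfl

theorem Continuous.integrable_unitCube {n : ℕ} {E : Type*} [NormedAddCommGroup E]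
    {F : (Fin n → ℝ) → E} (hF : Continuous F) :
    Integrable F (Measure.pi fun _ => unitMeasure) := by
  rw [← restrict_unitCube]
  exact hF.continuousOn.integrableOn_compact isCompact_Icc

theorem integral_cos_two_pi : ∫ x, cos (2 * π * x) ∂unitMeasure = 0 := by
  rw [unitMeasure, integral_Icc_eq_integral_Ioc, ← intervalIntegral.integral_of_le zero_le_one,
    intervalIntegral.integral_comp_mul_left _ (by positivity)]
  simp

theorem integral_cos_sq_two_pi : ∫ x, cos (2 * π * x) ^ 2 ∂unitMeasure = 1 / 2 := by
  rw [unitMeasure, integral_Icc_eq_integral_Ioc, ← intervalIntegral.integral_of_le zero_le_one,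
    intervalIntegral.integral_comp_mul_left (fun x => cos x ^ 2) (by positivity),
    integral_cos_sq]
  simp
  field_simp

theorem integral_quadratic_cos (p q r : ℝ) :
    ∫ x, (p + q * cos (2 * π * x) + r * cos (2 * π * x) ^ 2) ∂unitMeasure = p + r / 2 := by
  have h1 : Integrable (fun x => q * cos (2 * π * x)) unitMeasure :=
    (by fun_prop : Continuous _).integrableOn_Icc
  have h2 : Integrable (fun x => r * cos (2 * π * x) ^ 2) unitMeasure :=
    (by fun_prop : Continuous _).integrableOn_Icc
  have h3 : Integrable (fun x => p + q * cos (2 * π * x)) unitMeasure :=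
    (integrable_const _).add h1
  rw [integral_add h3 h2, integral_add (integrable_const _) h1,
    integral_const_mul, integral_const_mul, integral_cos_two_pi, integral_cos_sq_two_pi]
  simp
  ring

theorem add_sq_div_six_le_mul_log {c : ℝ} (h1 : -1 ≤ c) (h2 : c ≤ 1) :
    c + c ^ 2 / 6 ≤ (1 + c) * log (1 + c) := by
  rcases h1.eq_or_lt with rfl | h1
  · norm_num
  have hp : 0 < 1 + c := by linarith
  set r := √(1 + c) with hr
  have hr0 : 0 < r := Real.sqrt_pos.2 hp
  have hsq : r ^ 2 = 1 + c := Real.sq_sqrt hp.le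
  have hr2 : r ≤ 1.42 := by nlinarith
  have hlog : 1 - r⁻¹ ≤ log r := by
    have := Real.log_le_sub_one_of_pos (inv_pos.2 hr0)
    rw [Real.log_inv] at this
    linarith
  have hc : c = r ^ 2 - 1 := by linarith
  rw [← hsq, Real.log_pow, hc]
  have h3 : r ^ 2 * (1 - r⁻¹) = r ^ 2 - r := by field_simp
  have h4 : r ^ 2 * (1 - r⁻¹) ≤ r ^ 2 * log r := by gcongr
  have h5 : (r ^ 2 - 1) ^ 2 ≤ 6 * (r - 1) ^ 2 := by
    have : (r + 1) ^ 2 ≤ 6 := by nlinarith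
    nlinarith [sq_nonneg (r - 1)]
  push_cast
  nlinarith

theorem integral_pi_succ {n : ℕ} {F : (Fin (n + 1) → ℝ) → ℝ} (hF : Continuous F) :
    Integrable (fun t => ∫ x : Fin n → ℝ, F (Fin.cons t x) ∂Measure.pi fun _ => unitMeasure)
        unitMeasure ∧
      ∫ x, F x ∂(Measure.pi fun _ => unitMeasure) =
        ∫ t, ∫ x : Fin n → ℝ, F (Fin.cons t x) ∂(Measure.pi fun _ => unitMeasure)
          ∂unitMeasure := by
  have e := (measurePreserving_piFinSuccAbove (fun _ : Fin (n + 1) => unitMeasure) 0).symm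
  have hi := (e.integrable_comp_emb (MeasurableEquiv.measurableEmbedding _)).2
    hF.integrable_unitCube
  have key := e.integral_comp (MeasurableEquiv.measurableEmbedding _) F
  have hc : ∀ z : ℝ × (Fin n → ℝ),
      (MeasurableEquiv.piFinSuccAbove (fun _ : Fin (n + 1) => ℝ) 0).symm z
        = Fin.cons z.1 z.2 := by
    intro z
    simp [MeasurableEquiv.piFinSuccAbove]
    rfl
  simp only [Function.comp_def, hc] at hi key
  refine ⟨hi.integral_prod_left, ?_⟩
  rw [← key]
  exact integral_prod _ hi

theorem prod_Iio_succ {n : ℕ} (f : Fin (n + 1) → ℝ) (j : Fin n) :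
    ∏ k ∈ Finset.Iio j.succ, f k = f 0 * ∏ k ∈ Finset.Iio j, f k.succ := by
  have h : Finset.Iio j.succ = insert 0 ((Finset.Iio j).image Fin.succ) := by
    ext k
    refine Fin.cases ?_ (fun i => ?_) k
    · simp
    · simp
  rw [h, Finset.prod_insert (by simp),
    Finset.prod_image (fun a _ b _ hab => Fin.succ_injective n hab)]

/-- A Bellman-type induction: `R` is the current value of the Riesz product, `m` its running maximum
and `S`, `β` the current lower bounds for twice the target and for the target. -/
theorem riesz_bellman (n : ℕ) : ∀ (F : (Fin n → ℝ) → ℝ), Continuous F → ∀ R m S β : ℝ,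
    0 ≤ R → 0 < m → R ≤ 2 * m → S ≤ m → S ≤ 2 * β → (∀ x, β ≤ F x) →
    (∀ x j, R * |cos (2 * π * x j)| * ∏ k ∈ Finset.Iio j, (1 + cos (2 * π * x k)) ≤ F x) →
    S + R / 6 * (n / 12 + log R - log m - log 2) ≤
      2 * ∫ x, F x ∂(Measure.pi fun _ => unitMeasure) := by
  induction n with
  | zero =>
    intro F hF R m S β hR hm hRm hSm hSβ hβ _
    have h1 : R / 6 * (log R - log m - log 2) ≤ 0 := by
      rcases hR.eq_or_lt with rfl | hR
      · simp
      · have := Real.log_le_log hR hRm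
        rw [Real.log_mul two_ne_zero hm.ne'] at this
        exact mul_nonpos_of_nonneg_of_nonpos (by positivity) (by linarith)
    have h2 : β ≤ ∫ x, F x ∂(Measure.pi fun _ => unitMeasure) := by
      calc β = ∫ _, β ∂(Measure.pi fun _ : Fin 0 => unitMeasure) := by simp
        _ ≤ _ := integral_mono (integrable_const _) hF.integrable_unitCube hβ
    simp only [Nat.cast_zero, zero_div, zero_add]
    linarith
  | succ n ih =>
    intro F hF R m S β hR hm hRm hSm hSβ hβ hFj
    obtain ⟨hint, hEq⟩ := integral_pi_succ hF
    set M := max m R with hM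
    have hMm : m ≤ M := le_max_left _ _
    have hMR : R ≤ M := le_max_right _ _
    have hMpos : 0 < M := hm.trans_le hMm
    set A : ℝ := n / 12 + log R - log M - log 2 with hA
    have hlog : R * (log M - log m) ≤ 2 * (M - m) := by
      have h1 : log M - log m ≤ M / m - 1 := by
        rw [← Real.log_div hMpos.ne' hm.ne']
        exact Real.log_le_sub_one_of_pos (by positivity)
      calc R * (log M - log m) ≤ R * (M / m - 1) := by gcongr
        _ = R / m * (M - m) := by field_simp
        _ ≤ 2 * (M - m) := by
          have h2 : R / m ≤ 2 := by rwa [div_le_iff₀ hm]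
          exact mul_le_mul_of_nonneg_right h2 (by linarith)
    have hpt : ∀ t, (S - (M - m) / 3 + R / 6 * A) + (R / 6 * A + R / 6) * cos (2 * π * t) +
        (4 * (M - m) / 3 + R / 36) * cos (2 * π * t) ^ 2 ≤
        2 * ∫ x : Fin n → ℝ, F (Fin.cons t x) ∂(Measure.pi fun _ => unitMeasure) := by
      intro t
      set c := cos (2 * π * t) with hc
      have hc1 : -1 ≤ c := neg_one_le_cos _
      have hc2 : c ≤ 1 := cos_le_one _
      have hcsq : c ^ 2 ≤ 1 := by nlinarith
      have step := ih (fun x => F (Fin.cons t x)) (hF.comp (by fun_prop)) (R * (1 + c)) M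
        (S + (M - m) * ((4 * c ^ 2 - 1) / 3)) (max β (R * |c|)) (by nlinarith) hMpos
        (by nlinarith) (by nlinarith) ?_ ?_ ?_
      · have hlogR : R * (1 + c) * log R + R * (c + c ^ 2 / 6) ≤
            R * (1 + c) * log (R * (1 + c)) := by
          have hcl := add_sq_div_six_le_mul_log hc1 hc2
          rcases hR.eq_or_lt with rfl | hR
          · simp
          rcases hc1.eq_or_lt with hc1 | hc1
          · rw [← hc1]
            norm_num
            linarith
          · rw [Real.log_mul hR.ne' (by linarith)]
            nlinarith
        refine le_trans ?_ step
        rw [hA]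
        nlinarith
      · rcases le_or_gt |c| (1 / 2) with h | h
        · have h4 : c ^ 2 ≤ 1 / 4 := by
            rw [← sq_abs]
            nlinarith [abs_nonneg c]
          have := le_max_left β (R * |c|)
          nlinarith
        · rcases le_total R m with h5 | h5
          · have := le_max_left β (R * |c|)
            have hMm' : M = m := max_eq_left h5
            rw [hMm']
            linarith
          · have := le_max_right β (R * |c|)
            have hMR' : M = R := max_eq_right h5
            rw [hMR'] at hMm ⊢
            nlinarith
      · intro x
        refine max_le (hβ _) ?_
        have h0 : Finset.Iio (0 : Fin (n + 1)) = ∅ := by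
          ext k
          simp
        simpa [h0] using hFj (Fin.cons t x) 0
      · intro x j
        have := hFj (Fin.cons t x) j.succ
        rw [prod_Iio_succ] at this
        simp only [Fin.cons_succ, Fin.cons_zero] at this
        refine le_trans (le_of_eq ?_) this
        ring
    have hmono := integral_mono ?_ (hint.const_mul 2) hpt
    · rw [integral_quadratic_cos, integral_const_mul, ← hEq] at hmono
      refine le_trans ?_ hmono
      rw [hA]
      push_cast
      nlinarith
    · exact (by fun_prop : Continuous _).integrableOn_Icc

theorem riesz_max_lower_bound {n : ℕ} {F : (Fin n → ℝ) → ℝ} (hF : Continuous F)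
    (h0 : ∀ x, 0 ≤ F x)
    (h : ∀ x j, |cos (2 * π * x j)| * ∏ k ∈ Finset.Iio j, (1 + cos (2 * π * x k)) ≤ F x) :
    (n : ℝ) / 144 ≤ ∫ x, F x ∂(Measure.pi fun _ => unitMeasure) := by
  have := riesz_bellman n F hF 1 (1 / 2) 0 0 zero_le_one (by norm_num) (by norm_num)
    (by norm_num) (by norm_num) h0 (by simpa using h)
  rw [Real.log_one, one_div 2, Real.log_inv] at this
  linarith

/-- Averaging over signs dominates each single coefficient. -/
theorem card_mul_abs_le_sum_signs {n : ℕ} (a : Fin n → ℝ) (k : Fin n) :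
    (Fintype.card (Fin n → ℤˣ) : ℝ) * |a k| ≤
      ∑ σ : Fin n → ℤˣ, |∑ j, ((σ j : ℤ) : ℝ) * a j| := by
  let flip : (Fin n → ℤˣ) → (Fin n → ℤˣ) := fun σ j => if j = k then σ j else -σ j
  have hflip : Function.Involutive flip := by
    intro σ
    funext j
    by_cases hj : j = k <;> simp [flip, hj]
  have h1 : ∀ σ : Fin n → ℤˣ, 2 * |a k| ≤
      |∑ j, ((σ j : ℤ) : ℝ) * a j| + |∑ j, ((flip σ j : ℤ) : ℝ) * a j| := by
    intro σ
    refine le_trans (le_of_eq ?_) (abs_add_le _ _)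
    rw [← Finset.sum_add_distrib, Finset.sum_eq_single k]
    · simp only [flip, if_true]
      rcases Int.units_eq_one_or (σ k) with h | h <;> simp [h, ← two_mul, abs_mul]
    · intro j _ hj
      simp [flip, hj]
    · simp
  have h2 := Finset.sum_le_sum fun σ (_ : σ ∈ Finset.univ) => h1 σ
  rw [Finset.sum_add_distrib, Finset.sum_const, Finset.card_univ, nsmul_eq_mul] at h2
  have h3 : ∑ σ, |∑ j, ((flip σ j : ℤ) : ℝ) * a j| =
      ∑ σ : Fin n → ℤˣ, |∑ j, ((σ j : ℤ) : ℝ) * a j| :=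
    (Equiv.sum_comp hflip.toPerm fun σ : Fin n → ℤˣ => |∑ j, ((σ j : ℤ) : ℝ) * a j|)
  rw [h3] at h2
  linarith

/-- A signed Riesz sum as a function of the values of the cosines. -/
noncomputable def signedRieszSum {n : ℕ} (σ : Fin n → ℝ) (c : Fin n → ℝ) : ℝ :=
  |∑ j, σ j * c j * ∏ k ∈ Finset.Iio j, (1 + c k)|

theorem continuous_signedRieszSum {n : ℕ} (σ : Fin n → ℝ) : Continuous (signedRieszSum σ) := by
  unfold signedRieszSum
  fun_prop

theorem exists_signs_independent (n : ℕ) : ∃ σ : Fin n → ℝ, (∀ j, σ j = 1 ∨ σ j = -1) ∧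
    (n : ℝ) / 144 ≤ ∫ x, signedRieszSum σ (fun k => cos (2 * π * x k))
      ∂(Measure.pi fun _ => unitMeasure) := by
  let f : (Fin n → ℤˣ) → (Fin n → ℝ) → ℝ := fun σ x =>
    signedRieszSum (fun j => ((σ j : ℤ) : ℝ)) (fun k => cos (2 * π * x k))
  have hf : ∀ σ, Continuous (f σ) := fun σ =>
    (continuous_signedRieszSum _).comp (by fun_prop)
  have hcard : (0 : ℝ) < Fintype.card (Fin n → ℤˣ) := by exact_mod_cast Fintype.card_pos
  have key := riesz_max_lower_bound
    (F := fun x => (∑ σ, f σ x) / Fintype.card (Fin n → ℤˣ)) (by fun_prop)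
    (fun x => div_nonneg (Finset.sum_nonneg fun σ _ => abs_nonneg _) hcard.le) ?_
  · rw [integral_div, integral_finsetSum _ fun σ _ => (hf σ).integrable_unitCube,
      le_div_iff₀ hcard, mul_comm, ← nsmul_eq_mul, ← Finset.card_univ, ← Finset.sum_const] at key
    obtain ⟨σ, -, hσ⟩ := Finset.exists_le_of_sum_le Finset.univ_nonempty key
    refine ⟨fun j => ((σ j : ℤ) : ℝ), fun j => ?_, hσ⟩
    rcases Int.units_eq_one_or (σ j) with h | h <;> simp [h]
  · intro x j
    have hP : 0 ≤ ∏ k ∈ Finset.Iio j, (1 + cos (2 * π * x k)) :=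
      Finset.prod_nonneg fun k _ => by linarith [neg_one_le_cos (2 * π * x k)]
    rw [le_div_iff₀ hcard, mul_comm]
    have := card_mul_abs_le_sum_signs
      (fun j => cos (2 * π * x j) * ∏ k ∈ Finset.Iio j, (1 + cos (2 * π * x k))) j
    rw [abs_mul, abs_of_nonneg hP] at this
    simpa only [f, signedRieszSum, mul_assoc] using this

theorem integral_fourier_unit (w : ℤ) :
    ∫ x : ℝ, fourier w (x : UnitAddCircle) ∂unitMeasure = if w = 0 then 1 else 0 := by
  have h := fourierCoeff_fourier (T := 1) w
  have h2 := congrFun h 0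
  rw [fourierCoeff_eq_intervalIntegral _ _ 0] at h2
  rw [unitMeasure, integral_Icc_eq_integral_Ioc, ← intervalIntegral.integral_of_le zero_le_one]
  simpa [Pi.single_apply, eq_comm] using h2

/-- The point of the torus with coordinates `⟨v k, ξ⟩` modulo one. -/
noncomputable def torusPoint {s d : ℕ} (v : Fin s → Fin d → ℤ) (ξ : Fin d → ℝ) :
    UnitAddTorus (Fin s) :=
  fun k => ((∑ i, (v k i : ℝ) * ξ i : ℝ) : UnitAddCircle)

theorem continuous_torusPoint {s d : ℕ} (v : Fin s → Fin d → ℤ) :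
    Continuous (torusPoint v) := by
  refine continuous_pi fun k => (AddCircle.continuous_mk' (1 : ℝ)).comp ?_
  fun_prop

theorem mFourier_torusPoint {s d : ℕ} (v : Fin s → Fin d → ℤ) (n : Fin s → ℤ) (ξ : Fin d → ℝ) :
    UnitAddTorus.mFourier n (torusPoint v ξ) =
      ∏ i, fourier ((∑ k, n k • v k) i) (ξ i : UnitAddCircle) := by
  simp only [UnitAddTorus.mFourier, ContinuousMap.coe_mk, torusPoint, fourier_coe_apply]
  rw [← Complex.exp_sum, ← Complex.exp_sum]
  congr 1
  simp only [Finset.sum_apply, Pi.smul_apply, smul_eq_mul]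
  push_cast
  simp only [Finset.mul_sum, Finset.sum_mul, div_one]
  rw [Finset.sum_comm]
  refine Finset.sum_congr rfl fun i _ => Finset.sum_congr rfl fun k _ => ?_
  ring

theorem integral_mFourier_torusPoint {s d : ℕ} (v : Fin s → Fin d → ℤ) (n : Fin s → ℤ) :
    ∫ ξ, UnitAddTorus.mFourier n (torusPoint v ξ) ∂(Measure.pi fun _ => unitMeasure) =
      if ∑ k, n k • v k = 0 then 1 else 0 := by
  simp only [mFourier_torusPoint]
  rw [integral_fintype_prod_eq_prod
    (f := fun i (x : ℝ) => fourier ((∑ k, n k • v k) i) (x : UnitAddCircle))]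
  simp only [integral_fourier_unit]
  rw [Finset.prod_ite_zero]
  simp [funext_iff]

/-- The vectors `v k` satisfy no nontrivial integer relation with coefficients at most `N`. -/
def NoRelation {s d : ℕ} (N : ℕ) (v : Fin s → Fin d → ℤ) : Prop :=
  ∀ n : Fin s → ℤ, (∀ k, |n k| ≤ N) → ∑ k, n k • v k = 0 → n = 0

theorem NoRelation.mono {s d N N' : ℕ} {v : Fin s → Fin d → ℤ} (h : NoRelation N' v)
    (hN : N ≤ N') : NoRelation N v := fun n hn h0 =>
  h n (fun k => (hn k).trans (by exact_mod_cast hN)) h0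

theorem noRelation_single (s N : ℕ) :
    NoRelation N (fun k : Fin s => (Pi.single k 1 : Fin s → ℤ)) := by
  intro n _ h
  funext k
  simpa [Finset.sum_apply, Pi.single_apply] using congrFun h k

theorem exists_integral_eq_of_mem_span {s : ℕ} {f : C(UnitAddTorus (Fin s), ℂ)}
    (hf : f ∈ Submodule.span ℂ (Set.range (UnitAddTorus.mFourier (d := Fin s)))) :
    ∃ (N : ℕ) (a : ℂ), ∀ (d : ℕ) (v : Fin s → Fin d → ℤ), NoRelation N v →
      ∫ ξ, f (torusPoint v ξ) ∂(Measure.pi fun _ => unitMeasure) = a := by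
  induction hf using Submodule.span_induction with
  | mem f hf =>
    obtain ⟨n, rfl⟩ := hf
    refine ⟨∑ k, (n k).natAbs, if n = 0 then 1 else 0, fun d v hv => ?_⟩
    rw [integral_mFourier_torusPoint]
    congr 1
    refine propext ⟨fun h => hv n (fun k => ?_) h, fun h => by simp [h]⟩
    rw [Int.abs_eq_natAbs]
    exact_mod_cast Finset.single_le_sum (f := fun k => (n k).natAbs) (fun _ _ => Nat.zero_le _)
      (Finset.mem_univ k)
  | zero => exact ⟨0, 0, fun d v _ => by simp⟩
  | add f g _ _ hf hg =>
    obtain ⟨N, a, hf⟩ := hf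
    obtain ⟨N', b, hg⟩ := hg
    refine ⟨max N N', a + b, fun d v hv => ?_⟩
    rw [← hf d v (hv.mono (le_max_left _ _)), ← hg d v (hv.mono (le_max_right _ _))]
    exact integral_add (f.continuous.comp (continuous_torusPoint v)).integrable_unitCube
      (g.continuous.comp (continuous_torusPoint v)).integrable_unitCube
  | smul c f _ hf =>
    obtain ⟨N, a, hf⟩ := hf
    refine ⟨N, c * a, fun d v hv => ?_⟩
    rw [← hf d v hv, ← integral_const_mul]
    rfl

/-- Vectors without short integer relations equidistribute the torus up to a given error. -/
theorem exists_noRelation_integral_close {s : ℕ} {Φ : UnitAddTorus (Fin s) → ℝ}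
    (hΦ : Continuous Φ) {ε : ℝ} (hε : 0 < ε) :
    ∃ N : ℕ, ∀ (d : ℕ) (v : Fin s → Fin d → ℤ), NoRelation N v →
      ∫ x : Fin s → ℝ, Φ (fun k => (x k : UnitAddCircle)) ∂(Measure.pi fun _ => unitMeasure) - ε ≤
        ∫ ξ, Φ (torusPoint v ξ) ∂(Measure.pi fun _ => unitMeasure) := by
  let g : C(UnitAddTorus (Fin s), ℂ) := ⟨fun x => (Φ x : ℂ), by fun_prop⟩
  have hg : g ∈ (Submodule.span ℂ
      (Set.range (UnitAddTorus.mFourier (d := Fin s)))).topologicalClosure := by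
    rw [UnitAddTorus.span_mFourier_closure_eq_top]
    trivial
  obtain ⟨f, hf, hfg⟩ := Metric.mem_closure_iff.1 hg (ε / 2) (half_pos hε)
  obtain ⟨N, a, ha⟩ := exists_integral_eq_of_mem_span hf
  have hclose : ∀ (d : ℕ) (v : Fin s → Fin d → ℤ), NoRelation N v →
      |∫ ξ, Φ (torusPoint v ξ) ∂(Measure.pi fun _ => unitMeasure) - a.re| ≤ ε / 2 := by
    intro d v hv
    have hgi := (g.continuous.comp (continuous_torusPoint v)).integrable_unitCube
    have hfi := (f.continuous.comp (continuous_torusPoint v)).integrable_unitCube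
    have h1 : ∫ ξ, g (torusPoint v ξ) ∂(Measure.pi fun _ => unitMeasure) =
        ((∫ ξ, Φ (torusPoint v ξ) ∂(Measure.pi fun _ => unitMeasure) : ℝ) : ℂ) :=
      integral_ofReal
    have h2 : ‖∫ ξ, (g (torusPoint v ξ) - f (torusPoint v ξ))
        ∂(Measure.pi fun _ => unitMeasure)‖ ≤ ε / 2 := by
      refine (norm_integral_le_of_norm_le_const (C := ε / 2) (ae_of_all _ fun ξ => ?_)).trans
        (by simp)
      rw [← dist_eq_norm]
      exact (ContinuousMap.dist_apply_le_dist _).trans hfg.le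
    have h3 := integral_sub hgi hfi
    simp only [Function.comp_apply] at h3
    rw [h3, ha d v hv, h1] at h2
    refine le_trans ?_ h2
    refine le_trans (le_of_eq ?_) (Complex.abs_re_le_norm _)
    simp
  refine ⟨N, fun d v hv => ?_⟩
  have h1 := abs_le.1 (hclose d v hv)
  have h2 := abs_le.1 (hclose s _ (noRelation_single s N))
  have h3 : ∀ x : Fin s → ℝ, torusPoint (fun k : Fin s => (Pi.single k 1 : Fin s → ℤ)) x =
      fun k => (x k : UnitAddCircle) := by
    intro x
    funext k
    simp [torusPoint, Pi.single_apply]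
  simp only [h3] at h2
  linarith [h1.1, h2.2]

theorem intNorm_eq_norm {d : ℕ} (n : Fin d → ℤ) :
    intNorm n = ‖WithLp.toLp 2 fun i => (n i : ℝ)‖ := by
  simp [intNorm, EuclideanSpace.norm_eq]

theorem intNorm_pos {d : ℕ} {n : Fin d → ℤ} (hn : n ≠ 0) : 0 < intNorm n := by
  rw [intNorm_eq_norm, norm_pos_iff]
  contrapose! hn
  funext i
  simpa using congrArg (fun x : EuclideanSpace ℝ (Fin d) => x i) hn

theorem intNorm_smul {d : ℕ} (a : ℤ) (n : Fin d → ℤ) : intNorm (a • n) = |(a : ℝ)| * intNorm n := by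
  rw [intNorm_eq_norm, intNorm_eq_norm, ← Real.norm_eq_abs, ← norm_smul]
  congr 1
  ext i
  simp

theorem intNorm_sum_le {d : ℕ} {ι : Type*} (t : Finset ι) (f : ι → Fin d → ℤ) :
    intNorm (∑ k ∈ t, f k) ≤ ∑ k ∈ t, intNorm (f k) := by
  simp only [intNorm_eq_norm]
  refine le_trans (le_of_eq ?_) (norm_sum_le _ _)
  congr 1
  ext i
  simp [WithLp.ofLp_sum]

theorem noRelation_of_lacunary {s d N : ℕ} {M : ℝ} (hM : (N * s + 1 : ℝ) ≤ M)
    {v : Fin s → Fin d → ℤ} (hv : ∀ k, v k ≠ 0)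
    (hlac : ∀ k l : Fin s, (l : ℕ) = (k : ℕ) + 1 → M * intNorm (v k) < intNorm (v l)) :
    NoRelation N v := by
  have hpos : ∀ k, 0 < intNorm (v k) := fun k => intNorm_pos (hv k)
  have hM1 : 1 ≤ M := le_trans (by linarith [(by positivity : (0 : ℝ) ≤ N * s)]) hM
  have hlt : ∀ l : ℕ, ∀ hl : l < s, ∀ k : Fin s, (k : ℕ) < l →
      M * intNorm (v k) < intNorm (v ⟨l, hl⟩) := by
    intro l
    induction l with
    | zero => intro _ k hk; omega
    | succ l ih =>
      intro hl k hk
      have h1 := hlac ⟨l, by omega⟩ ⟨l + 1, hl⟩ rfl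
      rcases Nat.lt_succ_iff_lt_or_eq.1 hk with hk | rfl
      · have h2 := ih (by omega) k hk
        have h3 := hpos ⟨l, by omega⟩
        nlinarith
      · exact h1
  intro n hn hsum
  by_contra hne
  obtain ⟨k₀, hk₀⟩ := Function.ne_iff.1 hne
  obtain ⟨K, hK, hmax⟩ := (Finset.univ.filter fun k => n k ≠ 0).exists_max_image id
    ⟨k₀, by simpa using hk₀⟩
  simp only [Finset.mem_filter, Finset.mem_univ, true_and, id] at hK hmax
  have hzero : ∀ k, K < k → n k = 0 := fun k hk => by
    by_contra h
    exact absurd (hmax k h) (not_le.2 hk)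
  have hrel : n K • v K = -∑ k ∈ Finset.Iio K, n k • v k := by
    rw [eq_neg_iff_add_eq_zero, ← hsum, ← Finset.sum_insert (f := fun k => n k • v k) (by simp)]
    refine Finset.sum_subset (Finset.subset_univ _) fun k _ hk => ?_
    simp only [Finset.mem_insert, Finset.mem_Iio, not_or, not_lt] at hk
    rw [hzero k (lt_of_le_of_ne hk.2 (Ne.symm hk.1)), zero_smul]
  have hneg : ∀ w : Fin d → ℤ, intNorm (-w) = intNorm w := fun w => by simp [intNorm]
  have h1 : intNorm (v K) ≤ intNorm (n K • v K) := by
    rw [intNorm_smul]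
    refine le_mul_of_one_le_left (hpos K).le ?_
    exact_mod_cast Int.one_le_abs hK
  have h2 : intNorm (n K • v K) ≤ ∑ k ∈ Finset.Iio K, N * intNorm (v k) := by
    rw [hrel, hneg]
    refine (intNorm_sum_le _ _).trans (Finset.sum_le_sum fun k _ => ?_)
    rw [intNorm_smul]
    gcongr
    · exact (hpos k).le
    · exact_mod_cast hn k
  have h3 : M * ∑ k ∈ Finset.Iio K, N * intNorm (v k) ≤ N * s * intNorm (v K) := by
    rw [Finset.mul_sum]
    calc ∑ k ∈ Finset.Iio K, M * (N * intNorm (v k))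
        ≤ ∑ _k ∈ Finset.Iio K, N * intNorm (v K) := by
          refine Finset.sum_le_sum fun k hk => ?_
          have := hlt K K.2 k (Fin.lt_def.1 (Finset.mem_Iio.1 hk))
          rw [mul_left_comm]
          gcongr
      _ = K * (N * intNorm (v K)) := by simp
      _ ≤ s * (N * intNorm (v K)) := by
          have := (hpos K).le
          have hKs : (K : ℝ) ≤ s := by exact_mod_cast K.2.le
          gcongr
      _ = _ := by ring
  have h4 : M * intNorm (v K) ≤ N * s * intNorm (v K) :=
    (mul_le_mul_of_nonneg_left (h1.trans h2) (by linarith)).trans h3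
  nlinarith [hpos K]

/-- There are a constant `C > 0` and, for each `s`, a lacunarity threshold `M(s)` and signs
`σ_j ∈ {−1,+1}` such that for every lacunary sequence `d^1,…,d^s` in `ℤ^d \ {0}` the signed
Riesz-product sum has `L¹([0,1]^d)` norm at least `C·s`. -/
theorem riesz_product_lower_bound_signs (d : ℕ) :
    ∃ C : ℝ, 0 < C ∧ ∀ s : ℕ, 0 < s →
      ∃ M : ℝ, 0 < M ∧ ∃ σ : Fin s → ℝ, (∀ j, σ j = 1 ∨ σ j = -1) ∧
        ∀ v : Fin s → (Fin d → ℤ), (∀ k, v k ≠ 0) →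
          (∀ k l : Fin s, (l : ℕ) = (k : ℕ) + 1 → M * intNorm (v k) < intNorm (v l)) →
          C * s ≤ ∫ ξ in Set.Icc (0 : Fin d → ℝ) 1,
            |∑ j : Fin s, σ j * Real.cos (2 * Real.pi * ∑ i, (v j i : ℝ) * ξ i) *
              ∏ k ∈ Finset.Iio j,
                (1 + Real.cos (2 * Real.pi * ∑ i, (v k i : ℝ) * ξ i))| := by
  refine ⟨1 / 288, by norm_num, fun s hs => ?_⟩
  obtain ⟨σ, hσ, hmodel⟩ := exists_signs_independent s
  have hs' : (0 : ℝ) < s := by exact_mod_cast hs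
  have hre : ∀ t : ℝ, (fourier 1 (t : UnitAddCircle)).re = cos (2 * π * t) := by
    intro t
    rw [fourier_coe_apply, ← Complex.exp_ofReal_mul_I_re]
    congr 2
    push_cast
    ring
  let Φ : UnitAddTorus (Fin s) → ℝ := fun x => signedRieszSum σ fun k => (fourier 1 (x k)).re
  have hΦ : Continuous Φ := (continuous_signedRieszSum σ).comp (by fun_prop)
  obtain ⟨N, hN⟩ := exists_noRelation_integral_close hΦ (ε := s / 288) (by positivity)
  refine ⟨N * s + 1, by positivity, σ, hσ, fun v hv hlac => ?_⟩
  have key := hN d v (noRelation_of_lacunary le_rfl hv hlac)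
  simp only [Φ, torusPoint, hre] at key
  rw [restrict_unitCube]
  refine le_trans ?_ key
  linarith
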